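/- Let F : Ω → ℝ^{n+1} be a hypersurface translating soliton with respect to the unit vector W, and S(x) = ⟨F(x), W⟩. Suppose there exists a smooth function u > 0 on Ω with Δ_g u − Σ_{i,j} g^{ij} ∂_i S ∂_j u + |A|² u ≤ 0 on Ω. Then the stability inequality holds: for every smooth compactly supported function f on Ω, ∫_Ω ( Σ_{i,j} g^{ij} ∂_i f ∂_j f − |A|² f² ) e^{−S} √g dx ≥ 0, where dx is Lebesgue measure on Ω. -/

import Mathlib

open Real MeasureTheory

noncomputable section

/-- Partial derivative of a scalar function in the `i`-th coordinate direction. -/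
def pd {n : ℕ} (i : Fin n) (φ : (Fin n → ℝ) → ℝ) (x : Fin n → ℝ) : ℝ :=
  fderiv ℝ φ x (Pi.single i 1)

/-- Induced metric `g_{ij} = ⟨∂_i F, ∂_j F⟩`. -/
def gmat {n m : ℕ} (F : (Fin n → ℝ) → (Fin m → ℝ)) (x : Fin n → ℝ) :
    Matrix (Fin n) (Fin n) ℝ :=
  Matrix.of fun i j => ∑ a, pd i (fun y => F y a) x * pd j (fun y => F y a) x

/-- Inverse metric `g^{ij}`. -/
def ginv {n m : ℕ} (F : (Fin n → ℝ) → (Fin m → ℝ)) (x : Fin n → ℝ) :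
    Matrix (Fin n) (Fin n) ℝ :=
  (gmat F x)⁻¹

/-- Laplace–Beltrami operator `Δ_g φ = g^{-1/2} Σ_{i,j} ∂_i (g^{1/2} g^{ij} ∂_j φ)`. -/
def lapB {n m : ℕ} (F : (Fin n → ℝ) → (Fin m → ℝ)) (φ : (Fin n → ℝ) → ℝ)
    (x : Fin n → ℝ) : ℝ :=
  (Real.sqrt (gmat F x).det)⁻¹ *
    ∑ i, ∑ j, pd i (fun y => Real.sqrt (gmat F y).det * ginv F y i j * pd j φ y) x

/-- Mean curvature vector `H̄ = Δ_g F` (componentwise). -/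
def Hvec {n m : ℕ} (F : (Fin n → ℝ) → (Fin m → ℝ)) (x : Fin n → ℝ) : Fin m → ℝ :=
  fun a => lapB F (fun y => F y a) x

/-- Tangential projection of an ambient vector `V` onto `span{∂_1 F(x), …, ∂_n F(x)}`:
`V^⊤ = Σ_{i,j} g^{ij} ⟨V, ∂_j F⟩ ∂_i F`. -/
def tproj {n m : ℕ} (F : (Fin n → ℝ) → (Fin m → ℝ)) (x : Fin n → ℝ)
    (V : Fin m → ℝ) : Fin m → ℝ :=
  fun a => ∑ i, ∑ j, ginv F x i j * (∑ b, V b * pd j (fun y => F y b) x)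
      * pd i (fun y => F y a) x

/-- `S(x) = ⟨F(x), W⟩`. -/
def Sfun {n m : ℕ} (F : (Fin n → ℝ) → (Fin m → ℝ)) (W : Fin m → ℝ)
    (x : Fin n → ℝ) : ℝ :=
  ∑ a, F x a * W a

/-- Second fundamental form `h_{ij} = ⟨∂_i ν, ∂_j F⟩`. -/
def sff {n m : ℕ} (F ν : (Fin n → ℝ) → (Fin m → ℝ)) (i j : Fin n) (x : Fin n → ℝ) : ℝ :=
  ∑ a, pd i (fun y => ν y a) x * pd j (fun y => F y a) x

/-- Scalar mean curvature `H = Σ_{i,j} g^{ij} h_{ij}`. -/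
def meanH {n m : ℕ} (F ν : (Fin n → ℝ) → (Fin m → ℝ)) (x : Fin n → ℝ) : ℝ :=
  ∑ i, ∑ j, ginv F x i j * sff F ν i j x

/-- `|A|² = Σ g^{ik} g^{jl} h_{ij} h_{kl}`. -/
def normA2 {n m : ℕ} (F ν : (Fin n → ℝ) → (Fin m → ℝ)) (x : Fin n → ℝ) : ℝ :=
  ∑ i, ∑ j, ∑ k, ∑ l, ginv F x i k * ginv F x j l * sff F ν i j x * sff F ν k l x

section PartialDerivatives

variable {n m : ℕ} {Ω : Set (Fin n → ℝ)}

theorem pd_mul {φ ψ : (Fin n → ℝ) → ℝ} {x : Fin n → ℝ} (i : Fin n)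
    (hφ : DifferentiableAt ℝ φ x) (hψ : DifferentiableAt ℝ ψ x) :
    pd i (fun y => φ y * ψ y) x = pd i φ x * ψ x + φ x * pd i ψ x := by
  simp only [pd, fderiv_fun_mul hφ hψ, add_apply, smul_apply, smul_eq_mul]
  ring

theorem pd_sq {φ : (Fin n → ℝ) → ℝ} {x : Fin n → ℝ} (i : Fin n)
    (hφ : DifferentiableAt ℝ φ x) :
    pd i (fun y => φ y ^ 2) x = 2 * φ x * pd i φ x := by
  simp only [sq, pd_mul i hφ hφ]
  ring

theorem pd_exp_neg {φ : (Fin n → ℝ) → ℝ} {x : Fin n → ℝ} (i : Fin n)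
    (hφ : DifferentiableAt ℝ φ x) :
    pd i (fun y => Real.exp (-φ y)) x = -(Real.exp (-φ x) * pd i φ x) := by
  have h : HasFDerivAt (fun y => Real.exp (-φ y)) (Real.exp (-φ x) • -fderiv ℝ φ x) x :=
    hφ.hasFDerivAt.fun_neg.exp
  simp [pd, h.fderiv]

theorem pd_inv {φ : (Fin n → ℝ) → ℝ} {x : Fin n → ℝ} (i : Fin n)
    (hφ : DifferentiableAt ℝ φ x) (h0 : φ x ≠ 0) :
    pd i (fun y => (φ y)⁻¹) x = -(pd i φ x / φ x ^ 2) := by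
  have h := (hasDerivAt_inv h0).comp_hasFDerivAt x hφ.hasFDerivAt
  have h' : HasFDerivAt (fun y => (φ y)⁻¹) (-(φ x ^ 2)⁻¹ • fderiv ℝ φ x) x := h
  simp only [pd, h'.fderiv, smul_apply, smul_eq_mul]
  ring

theorem ContDiffOn.pd {φ : (Fin n → ℝ) → ℝ} (hΩ : IsOpen Ω)
    (hφ : ContDiffOn ℝ (⊤ : ℕ∞) φ Ω) (i : Fin n) : ContDiffOn ℝ (⊤ : ℕ∞) (pd i φ) Ω :=
  (hφ.fderiv_of_isOpen hΩ (by norm_cast)).clm_apply contDiffOn_const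

/-- The integral of a partial derivative of a compactly supported `C¹` function vanishes. -/
theorem integral_pd_eq_zero {φ : (Fin n → ℝ) → ℝ} (hφ : ContDiff ℝ 1 φ)
    (hc : HasCompactSupport φ) (i : Fin n) :
    Integrable (pd i φ) ∧ ∫ x, pd i φ x = 0 := by
  have hcont : Continuous (pd i φ) := (hφ.continuous_fderiv one_ne_zero).clm_apply continuous_const
  have hint : Integrable (pd i φ) :=
    hcont.integrable_of_hasCompactSupport (hc.fderiv_apply (𝕜 := ℝ) _)
  refine ⟨hint, ?_⟩
  have h := integral_mul_fderiv_eq_neg_fderiv_mul_of_integrable (μ := volume)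
    (f := fun _ : Fin n → ℝ => (1 : ℝ)) (g := φ) (v := Pi.single i 1)
    (by simp) (by simp only [one_mul]; exact hint)
    (by simpa using hφ.continuous.integrable_of_hasCompactSupport hc)
    (fun x _ => differentiableAt_const _) (fun x _ => hφ.differentiable one_ne_zero x)
  simpa [pd] using h

theorem contDiff_of_contDiffOn_of_tsupport_subset {k : WithTop ℕ∞} {φ : (Fin n → ℝ) → ℝ}
    (hΩ : IsOpen Ω) (hφ : ContDiffOn ℝ k φ Ω) (hs : tsupport φ ⊆ Ω) : ContDiff ℝ k φ := by
  refine contDiff_iff_contDiffAt.2 fun x => ?_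
  by_cases hx : x ∈ Ω
  · exact hφ.contDiffAt (hΩ.mem_nhds hx)
  · exact contDiffAt_const.congr_of_eventuallyEq
      (notMem_tsupport_iff_eventuallyEq.1 fun h => hx (hs h))

theorem contDiffOn_det {k : WithTop ℕ∞} {A : (Fin n → ℝ) → Matrix (Fin m) (Fin m) ℝ}
    (hA : ∀ i j, ContDiffOn ℝ k (fun x => A x i j) Ω) :
    ContDiffOn ℝ k (fun x => (A x).det) Ω := by
  simp only [Matrix.det_apply']
  exact ContDiffOn.sum fun σ _ => contDiffOn_const.mul (contDiffOn_prod fun i _ => hA _ _)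

theorem contDiffOn_matrix_inv_apply {k : WithTop ℕ∞}
    {A : (Fin n → ℝ) → Matrix (Fin m) (Fin m) ℝ}
    (hA : ∀ i j, ContDiffOn ℝ k (fun x => A x i j) Ω) (h0 : ∀ x ∈ Ω, (A x).det ≠ 0)
    (i j : Fin m) : ContDiffOn ℝ k (fun x => (A x)⁻¹ i j) Ω := by
  simp only [Matrix.inv_def, Matrix.smul_apply, Ring.inverse_eq_inv', smul_eq_mul,
    Matrix.adjugate_apply]
  refine ((contDiffOn_det hA).inv h0).mul (contDiffOn_det fun a b => ?_)
  by_cases h : a = j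
  · subst h
    simpa using contDiffOn_const
  · simpa [Matrix.updateRow_ne h] using hA a b

theorem contDiffOn_gmat_apply {F : (Fin n → ℝ) → (Fin m → ℝ)} (hΩ : IsOpen Ω)
    (hF : ContDiffOn ℝ (⊤ : ℕ∞) F Ω) (i j : Fin n) :
    ContDiffOn ℝ (⊤ : ℕ∞) (fun x => gmat F x i j) Ω := by
  simp only [gmat, Matrix.of_apply]
  have hFa := contDiffOn_pi.1 hF
  exact ContDiffOn.sum fun a _ => ((hFa a).pd hΩ i).mul ((hFa a).pd hΩ j)

end PartialDerivatives

/-- The quadratic form inequality `2⟨p, c q⟩ - |c q|² ≤ |p|²`. -/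
theorem Matrix.PosDef.two_mul_sum_sub_le {n : ℕ} {A : Matrix (Fin n) (Fin n) ℝ}
    (hA : A.PosDef) (p q : Fin n → ℝ) (c : ℝ) :
    ∑ i, ∑ j, A i j * (2 * c * p i - c ^ 2 * q i) * q j ≤ ∑ i, ∑ j, A i j * p i * p j := by
  have hsymm : ∀ i j, A j i = A i j := fun i j => by simpa using hA.isHermitian.apply i j
  have hnonneg := hA.posSemidef.dotProduct_mulVec_nonneg (fun i => p i - c * q i)
  have hexp : star (fun i => p i - c * q i) ⬝ᵥ (A.mulVec fun i => p i - c * q i)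
      = ∑ i, ∑ j, A i j * (p i - c * q i) * (p j - c * q j) := by
    simp only [dotProduct, Matrix.mulVec, Finset.mul_sum, Pi.star_apply, star_trivial]
    exact Finset.sum_congr rfl fun i _ => Finset.sum_congr rfl fun j _ => by ring
  have hswap : ∑ i, ∑ j, A i j * q i * p j = ∑ i, ∑ j, A i j * p i * q j := by
    rw [Finset.sum_comm]
    exact Finset.sum_congr rfl fun i _ => Finset.sum_congr rfl fun j _ => by
      rw [hsymm]; ring
  have hsplit : ∑ i, ∑ j, A i j * (p i - c * q i) * (p j - c * q j)
      = ∑ i, ∑ j, A i j * p i * p j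
        - ∑ i, ∑ j, A i j * (2 * c * p i - c ^ 2 * q i) * q j
        + c * (∑ i, ∑ j, A i j * p i * q j - ∑ i, ∑ j, A i j * q i * p j) := by
    simp only [Finset.mul_sum, ← Finset.sum_sub_distrib, ← Finset.sum_add_distrib]
    exact Finset.sum_congr rfl fun i _ => Finset.sum_congr rfl fun j _ => by ring
  rw [hexp, hsplit, hswap] at hnonneg
  linarith

/-- A hypersurface translating soliton carrying a positive smooth
supersolution `u` of `Δ_g u − ⟨∇S, ∇u⟩ + |A|² u ≤ 0` is stable. -/
theorem soliton_stable_of_supersolution {n : ℕ} (hn : 1 ≤ n)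
    (Ω : Set (Fin n → ℝ)) (hΩo : IsOpen Ω) (hΩne : Ω.Nonempty)
    (F : (Fin n → ℝ) → (Fin (n + 1) → ℝ)) (hF : ContDiffOn ℝ (⊤ : ℕ∞) F Ω)
    (himm : ∀ x ∈ Ω, (gmat F x).PosDef)
    (ν : (Fin n → ℝ) → (Fin (n + 1) → ℝ)) (hν : ContDiffOn ℝ (⊤ : ℕ∞) ν Ω)
    (hνunit : ∀ x ∈ Ω, ∑ a, (ν x a) ^ 2 = 1)
    (hνperp : ∀ x ∈ Ω, ∀ i, ∑ a, ν x a * pd i (fun y => F y a) x = 0)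
    (W : Fin (n + 1) → ℝ) (hW : ∑ a, (W a) ^ 2 = 1)
    (hsol : ∀ x ∈ Ω, meanH F ν x = ∑ a, ν x a * W a)
    (u : (Fin n → ℝ) → ℝ) (hu : ContDiffOn ℝ (⊤ : ℕ∞) u Ω)
    (hupos : ∀ x ∈ Ω, 0 < u x)
    (husuper : ∀ x ∈ Ω,
      lapB F u x - (∑ i, ∑ j, ginv F x i j * pd i (Sfun F W) x * pd j u x)
        + normA2 F ν x * u x ≤ 0) :
    ∀ f : (Fin n → ℝ) → ℝ, ContDiff ℝ (⊤ : ℕ∞) f → HasCompactSupport f → tsupport f ⊆ Ω →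
      0 ≤ ∫ x in Ω,
        ((∑ i, ∑ j, ginv F x i j * pd i f x * pd j f x) - normA2 F ν x * f x ^ 2)
          * Real.exp (-(Sfun F W x)) * Real.sqrt (gmat F x).det := by
  intro f hf hfc hfs
  have hdet : ∀ x ∈ Ω, 0 < (gmat F x).det := fun x hx => (himm x hx).det_pos
  have hg := contDiffOn_gmat_apply hΩo hF
  have hw : ∀ i j, ContDiffOn ℝ (⊤ : ℕ∞)
      (fun y => Real.sqrt (gmat F y).det * ginv F y i j * pd j u y) Ω := fun i j =>
    (((contDiffOn_det hg).sqrt fun x hx => (hdet x hx).ne').mul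
      (contDiffOn_matrix_inv_apply hg (fun x hx => (hdet x hx).ne') i j)).mul (hu.pd hΩo j)
  have hS : ContDiffOn ℝ (⊤ : ℕ∞) (Sfun F W) Ω :=
    ContDiffOn.sum fun a _ => (contDiffOn_pi.1 hF a).mul contDiffOn_const
  have hE : ContDiffOn ℝ (⊤ : ℕ∞) (fun y => Real.exp (-Sfun F W y)) Ω := hS.neg.exp
  have hui : ContDiffOn ℝ (⊤ : ℕ∞) (fun y => (u y)⁻¹) Ω :=
    hu.inv fun x hx => (hupos x hx).ne'
  have hf2 : ContDiffOn ℝ (⊤ : ℕ∞) (fun y => f y ^ 2) Ω := (hf.pow 2).contDiffOn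
  have hdiff : ∀ {φ : (Fin n → ℝ) → ℝ}, ContDiffOn ℝ (⊤ : ℕ∞) φ Ω → ∀ x ∈ Ω,
      DifferentiableAt ℝ φ x := fun hφ x hx =>
    (hφ.contDiffAt (hΩo.mem_nhds hx)).differentiableAt (by simp)
  set w : Fin n → Fin n → (Fin n → ℝ) → ℝ :=
    fun i j y => Real.sqrt (gmat F y).det * ginv F y i j * pd j u y with hw_def
  set q : (Fin n → ℝ) → ℝ := fun y => Real.exp (-Sfun F W y) * (u y)⁻¹ * f y ^ 2 with hq_def
  have hq : ContDiffOn ℝ (⊤ : ℕ∞) q Ω := (hE.mul hui).mul hf2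
  have hX : ∀ i j, tsupport (fun y => w i j y * q y) ⊆ tsupport f := fun i j =>
    closure_mono fun y hy hfy => hy (by simp [hq_def, hfy])
  have hXint : ∀ i j, Integrable (pd i fun y => w i j y * q y) ∧
      ∫ x, pd i (fun y => w i j y * q y) x = 0 := fun i j =>
    integral_pd_eq_zero
      ((contDiff_of_contDiffOn_of_tsupport_subset hΩo ((hw i j).mul hq)
        ((hX i j).trans hfs)).of_le (by norm_cast))
      (hfc.of_isClosed_subset (isClosed_tsupport _) (hX i j)) i
  have hdivint : Integrable fun x => ∑ i, ∑ j, pd i (fun y => w i j y * q y) x :=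
    integrable_finsetSum _ fun i _ => integrable_finsetSum _ fun j _ => (hXint i j).1
  have hdiv0 : ∫ x in Ω, ∑ i, ∑ j, pd i (fun y => w i j y * q y) x = 0 := by
    rw [setIntegral_eq_integral_of_forall_compl_eq_zero, integral_finsetSum]
    · refine Finset.sum_eq_zero fun i _ => ?_
      rw [integral_finsetSum _ fun j _ => (hXint i j).1]
      exact Finset.sum_eq_zero fun j _ => (hXint i j).2
    · exact fun i _ => integrable_finsetSum _ fun j _ => (hXint i j).1
    · refine fun x hx => Finset.sum_eq_zero fun i _ => Finset.sum_eq_zero fun j _ => ?_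
      have h0 : x ∉ tsupport (fun y => w i j y * q y) := fun h => hx (hfs (hX i j h))
      simp [pd, fderiv_of_notMem_tsupport (𝕜 := ℝ) h0]
  have hpdq : ∀ x ∈ Ω, ∀ i, pd i q x = Real.exp (-Sfun F W x) *
      (-(f x ^ 2 / u x) * pd i (Sfun F W) x
        + (2 * (f x / u x) * pd i f x - (f x / u x) ^ 2 * pd i u x)) := fun x hx i => by
    have hfd : DifferentiableAt ℝ f x := hf.differentiable (by simp) x
    have hux := (hupos x hx).ne'
    rw [hq_def, pd_mul i (hdiff (hE.mul hui) x hx) (hdiff hf2 x hx),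
      pd_mul i (hdiff hE x hx) (hdiff hui x hx), pd_exp_neg i (hdiff hS x hx),
      pd_inv i (hdiff hu x hx) hux, pd_sq i hfd]
    field_simp
    ring
  have hle : ∀ x ∈ Ω, ∑ i, ∑ j, pd i (fun y => w i j y * q y) x ≤
      ((∑ i, ∑ j, ginv F x i j * pd i f x * pd j f x) - normA2 F ν x * f x ^ 2)
        * Real.exp (-(Sfun F W x)) * Real.sqrt (gmat F x).det := fun x hx => by
    have hs : 0 < Real.sqrt (gmat F x).det := Real.sqrt_pos.2 (hdet x hx)
    have hux := hupos x hx
    have hlap : ∑ i, ∑ j, pd i (w i j) x = Real.sqrt (gmat F x).det * lapB F u x := by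
      rw [lapB, mul_inv_cancel_left₀ hs.ne']
    have hquad : ∑ i, ∑ j, ginv F x i j *
        (2 * (f x / u x) * pd i f x - (f x / u x) ^ 2 * pd i u x) * pd j u x
        ≤ ∑ i, ∑ j, ginv F x i j * pd i f x * pd j f x :=
      (himm x hx).inv.two_mul_sum_sub_le (fun i => pd i f x) (fun i => pd i u x) (f x / u x)
    have hsum : ∑ i, ∑ j, pd i (fun y => w i j y * q y) x
        = q x * ∑ i, ∑ j, pd i (w i j) x
          + Real.sqrt (gmat F x).det * Real.exp (-Sfun F W x) *
            (-(f x ^ 2 / u x) * (∑ i, ∑ j, ginv F x i j * pd i (Sfun F W) x * pd j u x)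
            + ∑ i, ∑ j, ginv F x i j *
              (2 * (f x / u x) * pd i f x - (f x / u x) ^ 2 * pd i u x) * pd j u x) := by
      simp only [Finset.mul_sum, ← Finset.sum_add_distrib]
      refine Finset.sum_congr rfl fun i _ => Finset.sum_congr rfl fun j _ => ?_
      rw [pd_mul i (hdiff (hw i j) x hx) (hdiff hq x hx), hpdq x hx i, hw_def]
      ring
    have hsup := mul_le_mul_of_nonneg_left (husuper x hx) (by positivity : 0 ≤ f x ^ 2 / u x)
    have hcancel : f x ^ 2 / u x * (normA2 F ν x * u x) = normA2 F ν x * f x ^ 2 := by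
      field_simp
    have hqx : q x = Real.exp (-Sfun F W x) * (f x ^ 2 / u x) := by
      rw [hq_def]; ring
    rw [mul_add, mul_sub, hcancel, mul_zero] at hsup
    have hmain := mul_le_mul_of_nonneg_left (add_le_add hsup hquad)
      (by positivity : 0 ≤ Real.sqrt (gmat F x).det * Real.exp (-Sfun F W x))
    rw [hsum, hlap, hqx]
    linarith
  by_cases hint : IntegrableOn (fun x =>
      ((∑ i, ∑ j, ginv F x i j * pd i f x * pd j f x) - normA2 F ν x * f x ^ 2)
        * Real.exp (-(Sfun F W x)) * Real.sqrt (gmat F x).det) Ω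
  · rw [← hdiv0]
    exact setIntegral_mono_on hdivint.integrableOn hint hΩo.measurableSet hle
  · exact (integral_undef hint).ge
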